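/- arXiv:math/9604235 — 4 statements merged into one kernel-verified Lean document; each statement's English description precedes it below -/
import Mathlib

section
/- Let K be a nonempty compact convex subset of ℝ^d and let R : K × [0,1] → K × ℝ be a continuous map such that the second coordinate of R(x,0) is strictly negative for every x ∈ K and the second coordinate of R(x,1) is strictly greater than 1 for every x ∈ K ("the bottom moves down and the top moves up"). Then R has a fixed point: there exists (x,t) ∈ K × [0,1] with R(x,t) = (x,t). -/
open Equiv

/-- The `k`-th vertex of the simplex of the Freudenthal triangulation with base point `x`
in which the coordinate `i` is the `τ i`-th one to be incremented. -/
def kuhnVertex {n : ℕ} (x : Fin n → ℕ) (τ : Perm (Fin n)) (k : Fin (n + 1)) : Fin n → ℕ :=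
  fun i => x i + if (τ i).castSucc < k then 1 else 0

/-- The indicator modulo 2 that the facet opposite to vertex `k` carries every label but the
last. -/
def facetDet {n : ℕ} (L : (Fin n → ℕ) → Fin (n + 1)) (x : Fin n → ℕ) (τ : Perm (Fin n))
    (k : Fin (n + 1)) : ZMod 2 :=
  Matrix.det (Matrix.of fun j c : Fin n =>
    if L (kuhnVertex x τ (k.succAbove j)) = c.castSucc then 1 else 0)

/-- The indicator modulo 2 that a simplex carries every label. -/
def simplexDet {n : ℕ} (L : (Fin n → ℕ) → Fin (n + 1)) (x : Fin n → ℕ) (τ : Perm (Fin n)) :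
    ZMod 2 :=
  Matrix.det (Matrix.of fun k c : Fin (n + 1) => if L (kuhnVertex x τ k) = c then 1 else 0)

lemma exists_label_of_simplexDet_ne_zero {n : ℕ} {L : (Fin n → ℕ) → Fin (n + 1)}
    {x : Fin n → ℕ} {τ : Perm (Fin n)} (h : simplexDet L x τ ≠ 0) (c : Fin (n + 1)) :
    ∃ k, L (kuhnVertex x τ k) = c := by
  contrapose! h
  exact Matrix.det_eq_zero_of_column_eq_zero c fun k => by simp [h k]

lemma facetDet_eq_zero {n : ℕ} {L : (Fin n → ℕ) → Fin (n + 1)}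
    {x : Fin n → ℕ} {τ : Perm (Fin n)} {k : Fin (n + 1)} (c : Fin n)
    (h : ∀ j, L (kuhnVertex x τ (k.succAbove j)) ≠ c.castSucc) : facetDet L x τ k = 0 :=
  Matrix.det_eq_zero_of_column_eq_zero c fun j => by simp [h j]

lemma facetDet_congr {n : ℕ} {L : (Fin n → ℕ) → Fin (n + 1)}
    {x y : Fin n → ℕ} {τ ρ : Perm (Fin n)} {k l : Fin (n + 1)}
    (h : ∀ j, kuhnVertex x τ (k.succAbove j) = kuhnVertex y ρ (l.succAbove j)) :
    facetDet L x τ k = facetDet L y ρ l := by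
  simp only [facetDet, h]

lemma simplexDet_eq_sum_facetDet {n : ℕ} (L : (Fin n → ℕ) → Fin (n + 1)) (x : Fin n → ℕ)
    (τ : Perm (Fin n)) : simplexDet L x τ = ∑ k, facetDet L x τ k := by
  set M : Matrix (Fin (n + 1)) (Fin (n + 1)) (ZMod 2) :=
    Matrix.of fun k c => if L (kuhnVertex x τ k) = c then 1 else 0 with hM
  have h := Matrix.det_updateCol_sum M (Fin.last n) fun _ => 1
  have hsum : (fun k => ∑ c, (1 : ZMod 2) • M k c) = fun _ => 1 := by
    funext k
    simp [hM]
  have hsign : ∀ m : ℕ, (-1 : ZMod 2) ^ m = 1 := fun m => by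
    rw [show (-1 : ZMod 2) = 1 from rfl, one_pow]
  rw [hsum, one_smul, Matrix.det_succ_column _ (Fin.last n)] at h
  rw [simplexDet, ← hM, ← h]
  refine Finset.sum_congr rfl fun k _ => ?_
  rw [hsign, Matrix.updateCol_self, one_mul, one_mul, facetDet]
  congr 1
  ext j c
  simp [hM, Matrix.submatrix, Fin.succAbove_last]

lemma facetDet_swap {m : ℕ} (L : (Fin (m + 1) → ℕ) → Fin (m + 2)) (x : Fin (m + 1) → ℕ)
    (τ : Perm (Fin (m + 1))) (k : Fin m) :
    facetDet L x (swap k.castSucc k.succ * τ) k.castSucc.succ =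
      facetDet L x τ k.castSucc.succ := by
  refine facetDet_congr fun j => funext fun i => ?_
  have hj := Fin.succAbove_ne k.castSucc.succ j
  generalize (k.castSucc.succ).succAbove j = l at hj
  simp only [kuhnVertex, Perm.mul_apply, swap_apply_def, Fin.lt_def, Fin.ext_iff, ne_eq] at hj ⊢
  congr 2
  split_ifs <;> simp at * <;> omega

lemma sum_facetDet_interior {m : ℕ} (L : (Fin (m + 1) → ℕ) → Fin (m + 2))
    (x : Fin (m + 1) → ℕ) (k : Fin m) :
    ∑ τ : Perm (Fin (m + 1)), facetDet L x τ k.castSucc.succ = 0 := by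
  refine Finset.sum_involution (fun τ _ => swap k.castSucc k.succ * τ) ?_ ?_ ?_ ?_
  · intro τ _
    rw [facetDet_swap]
    exact CharTwo.add_self_eq_zero _
  · intro τ _ _ h
    have h1 : swap k.castSucc k.succ = 1 := mul_eq_right.mp h
    rw [swap_eq_one_iff] at h1
    simp [Fin.ext_iff] at h1
  · simp
  · intro τ _
    simp [← mul_assoc]

lemma kuhnVertex_finRotate {m : ℕ} (x : Fin (m + 1) → ℕ) (τ : Perm (Fin (m + 1)))
    (j : Fin (m + 1)) :
    kuhnVertex x (finRotate (m + 1) * τ) j.succ =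
      kuhnVertex (x + Pi.single (τ.symm (Fin.last m)) 1) τ j.castSucc := by
  funext i
  simp only [kuhnVertex, Perm.mul_apply, Pi.add_apply, Pi.single_apply, eq_symm_apply]
  rcases Fin.eq_castSucc_or_eq_last (τ i) with ⟨c, hc⟩ | hc
  · simp [hc, Fin.lt_def, Fin.ext_iff, c.2.ne]
  · simp [hc, Fin.lt_def]
    omega

lemma facetDet_finRotate {m : ℕ} (L : (Fin (m + 1) → ℕ) → Fin (m + 2)) (x : Fin (m + 1) → ℕ)
    (τ : Perm (Fin (m + 1))) :
    facetDet L x (finRotate (m + 1) * τ) 0 =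
      facetDet L (x + Pi.single (τ.symm (Fin.last m)) 1) τ (Fin.last _) :=
  facetDet_congr fun j => by
    rw [Fin.succAbove_zero, Fin.succAbove_last, kuhnVertex_finRotate]

lemma kuhnVertex_castSucc_last {m : ℕ} (x : Fin (m + 1) → ℕ) (τ : Perm (Fin (m + 1)))
    (j : Fin (m + 1)) :
    kuhnVertex x τ j.castSucc (τ.symm (Fin.last m)) = x (τ.symm (Fin.last m)) := by
  simp [kuhnVertex, Fin.lt_def]
  omega

/-- The base points of the simplices subdividing the cube of side `p`. -/
abbrev kuhnBox (n p : ℕ) : Finset (Fin n → ℕ) := Fintype.piFinset fun _ => Finset.range p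

/-- Labels that are admissible on the boundary of the cube of side `p`. -/
structure IsKuhnLabel {n : ℕ} (p : ℕ) (L : (Fin n → ℕ) → Fin (n + 1)) : Prop where
  ne_of_eq_zero : ∀ x i, x i = 0 → L x ≠ i.castSucc
  le_of_eq_top : ∀ x i, x i = p → L x ≤ i.castSucc

lemma sum_simplexDet_eq_top {m p : ℕ} {L : (Fin (m + 1) → ℕ) → Fin (m + 2)}
    (hL : IsKuhnLabel p L) :
    ∑ x ∈ kuhnBox (m + 1) p, ∑ τ, simplexDet L x τ =
      ∑ τ : Perm (Fin (m + 1)) with τ (Fin.last m) = Fin.last m,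
        ∑ x ∈ kuhnBox (m + 1) p with x (Fin.last m) + 1 = p,
          facetDet L x (finRotate (m + 1) * τ) 0 := by
  have key : ∀ τ : Perm (Fin (m + 1)),
      ∑ x ∈ kuhnBox (m + 1) p, facetDet L x (finRotate (m + 1) * τ) 0 +
        ∑ x ∈ kuhnBox (m + 1) p, facetDet L x τ (Fin.last _) =
      if τ (Fin.last m) = Fin.last m then
        ∑ x ∈ kuhnBox (m + 1) p with x (Fin.last m) + 1 = p,
          facetDet L x (finRotate (m + 1) * τ) 0 else 0 := by
    intro τ
    set i := τ.symm (Fin.last m) with hi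
    have hbot : ∑ x ∈ kuhnBox (m + 1) p with x i = 0, facetDet L x τ (Fin.last _) = 0 := by
      refine Finset.sum_eq_zero fun x hx => facetDet_eq_zero i fun j => ?_
      refine hL.ne_of_eq_zero _ _ ?_
      rw [Fin.succAbove_last, kuhnVertex_castSucc_last]
      exact (Finset.mem_filter.mp hx).2
    have hmid : ∑ x ∈ kuhnBox (m + 1) p with ¬ x i + 1 = p,
          facetDet L x (finRotate (m + 1) * τ) 0 =
        ∑ x ∈ kuhnBox (m + 1) p with ¬ x i = 0, facetDet L x τ (Fin.last _) := by
      refine Finset.sum_nbij' (fun x => x + Pi.single i 1) (fun x => x - Pi.single i 1)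
        ?_ ?_ ?_ ?_ fun x _ => facetDet_finRotate L x τ
      · intro x hx
        simp only [Finset.mem_filter, Fintype.mem_piFinset, Finset.mem_range] at hx ⊢
        refine ⟨fun a => ?_, by simp⟩
        have := hx.1 a
        rcases eq_or_ne a i with rfl | ha
        · simp; omega
        · simpa [ha]
      · intro x hx
        simp only [Finset.mem_filter, Fintype.mem_piFinset, Finset.mem_range] at hx ⊢
        refine ⟨fun a => (Nat.sub_le _ _).trans_lt (hx.1 a), ?_⟩
        have := hx.1 i
        simp; omega
      · intro x _
        simp
      · intro x hx
        simp only [Finset.mem_filter] at hx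
        funext a
        rcases eq_or_ne a i with rfl | ha
        · simp; omega
        · simp [ha]
    have htop : ∑ x ∈ kuhnBox (m + 1) p with x i + 1 = p,
          facetDet L x (finRotate (m + 1) * τ) 0 =
        if τ (Fin.last m) = Fin.last m then
        ∑ x ∈ kuhnBox (m + 1) p with x (Fin.last m) + 1 = p,
          facetDet L x (finRotate (m + 1) * τ) 0 else 0 := by
      split_ifs with h
      · rw [show i = Fin.last m by rw [hi, symm_apply_eq, h]]
      · refine Finset.sum_eq_zero fun x hx => ?_
        refine facetDet_eq_zero (Fin.last m) fun j => ?_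
        have hi' : i ≠ Fin.last m := fun h' => h (by rw [← h', hi, apply_symm_apply, ← hi, h'])
        refine ((hL.le_of_eq_top _ i ?_).trans_lt ?_).ne
        · rw [Fin.succAbove_zero, kuhnVertex_finRotate, kuhnVertex_castSucc_last]
          simpa using (Finset.mem_filter.mp hx).2
        · exact Fin.castSucc_lt_castSucc_iff.mpr (Fin.lt_last_iff_ne_last.mpr hi')
    rw [← Finset.sum_filter_add_sum_filter_not _ (fun x => x i + 1 = p),
      ← Finset.sum_filter_add_sum_filter_not (kuhnBox (m + 1) p) (fun x => x i = 0)
        (fun x => facetDet L x τ (Fin.last _)), hbot, hmid, zero_add, add_assoc,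
      CharTwo.add_self_eq_zero, add_zero, htop]
  rw [Finset.sum_filter, ← Finset.sum_congr rfl fun τ _ => key τ, Finset.sum_add_distrib]
  rw [show ∑ τ : Perm (Fin (m + 1)), ∑ x ∈ kuhnBox (m + 1) p,
      facetDet L x (finRotate (m + 1) * τ) 0 = _ from
    Equiv.sum_comp (Equiv.mulLeft (finRotate (m + 1)))
      fun τ => ∑ x ∈ kuhnBox (m + 1) p, facetDet L x τ 0]
  rw [← Finset.sum_add_distrib, Finset.sum_comm]
  simp_rw [← Finset.sum_add_distrib]
  rw [Finset.sum_comm, Finset.sum_comm (s := Finset.univ)]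
  refine Finset.sum_congr rfl fun x _ => ?_
  simp_rw [simplexDet_eq_sum_facetDet, Fin.sum_univ_succ (n := m + 1),
    Fin.sum_univ_castSucc (n := m), Finset.sum_add_distrib]
  rw [Finset.sum_comm, Finset.sum_eq_zero fun k _ => sum_facetDet_interior L x k, zero_add,
    Fin.succ_last]

lemma facetDet_top {m p : ℕ} {L : (Fin (m + 1) → ℕ) → Fin (m + 2)}
    {L' : (Fin m → ℕ) → Fin (m + 1)}
    (hL' : ∀ y, (L' y).castSucc = L (Fin.snoc (α := fun _ => ℕ) y p))
    {x : Fin (m + 1) → ℕ} (hx : x (Fin.last m) + 1 = p)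
    {τ : Perm (Fin (m + 1))} {τ' : Perm (Fin m)} (hτ : τ (Fin.last m) = Fin.last m)
    (hτ' : ∀ i : Fin m, τ i.castSucc = (τ' i).castSucc) :
    facetDet L x (finRotate (m + 1) * τ) 0 = simplexDet L' (Fin.init x) τ' := by
  have hsymm : τ.symm (Fin.last m) = Fin.last m := by rw [symm_apply_eq, hτ]
  have hv : ∀ j, kuhnVertex x (finRotate (m + 1) * τ) (Fin.succAbove 0 j) =
      Fin.snoc (α := fun _ => ℕ) (kuhnVertex (Fin.init x) τ' j) p := by
    intro j
    rw [Fin.succAbove_zero, kuhnVertex_finRotate, hsymm]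
    funext i
    refine Fin.lastCases ?_ (fun i => ?_) i
    · simp [kuhnVertex, hτ, hx, Fin.lt_def]
      omega
    · simp [kuhnVertex, hτ', Fin.init, Fin.lt_def, Fin.ext_iff, i.2.ne]
  simp only [facetDet, simplexDet, hv, ← hL', Fin.castSucc_inj]

lemma exists_perm_castSucc {m : ℕ} {τ : Perm (Fin (m + 1))} (hτ : τ (Fin.last m) = Fin.last m) :
    ∃ τ' : Perm (Fin m), finSuccEquivLast.symm.permCongr τ'.optionCongr = τ := by
  obtain ⟨⟨o, τ'⟩, h⟩ := Perm.decomposeOption.symm.surjective (finSuccEquivLast.permCongr τ)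
  have ho : o = none := by
    have := congrArg (fun e => e none) h
    simpa [hτ] using this
  subst ho
  refine ⟨τ', ?_⟩
  rw [← permCongr_symm, symm_apply_eq, ← h]
  simp [Perm.one_def]

lemma sum_simplexDet_eq_one {p : ℕ} (hp : 0 < p) : ∀ {n : ℕ} {L : (Fin n → ℕ) → Fin (n + 1)},
    IsKuhnLabel p L → ∑ x ∈ kuhnBox n p, ∑ τ, simplexDet L x τ = 1
  | 0, L, _ => by
    simp [simplexDet, Fin.fin_one_eq_zero]
  | m + 1, L, hL => by
    have hlt : ∀ y, ∃ c : Fin (m + 1), c.castSucc = L (Fin.snoc (α := fun _ => ℕ) y p) := fun y =>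
      Fin.exists_castSucc_eq.mpr
        ((hL.le_of_eq_top _ (Fin.last m) (by simp)).trans_lt (Fin.castSucc_lt_last _)).ne
    choose L' hL' using hlt
    have hK : IsKuhnLabel p L' := by
      refine ⟨fun x i hx h => ?_, fun x i hx => ?_⟩
      · refine hL.ne_of_eq_zero (Fin.snoc (α := fun _ => ℕ) x p) i.castSucc (by simpa) ?_
        rw [← hL', h]
      · rw [← Fin.castSucc_le_castSucc_iff, hL']
        exact hL.le_of_eq_top _ i.castSucc (by simpa)
    rw [sum_simplexDet_eq_top hL, ← sum_simplexDet_eq_one hp hK, Finset.sum_comm (s := kuhnBox m p)]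
    symm
    refine Finset.sum_bij (fun τ' _ => finSuccEquivLast.symm.permCongr τ'.optionCongr)
      ?_ ?_ ?_ ?_
    · intro τ' _
      simp
    · intro τ' _ ρ' _ h
      exact optionCongr_injective (permCongr _ |>.injective h)
    · intro τ hτ
      obtain ⟨τ', h⟩ := exists_perm_castSucc (Finset.mem_filter.mp hτ).2
      exact ⟨τ', Finset.mem_univ _, h⟩
    · intro τ' _
      refine Finset.sum_nbij' (fun x => Fin.snoc (α := fun _ => ℕ) x (p - 1))
        (fun x => Fin.init x) ?_ ?_ ?_ ?_ ?_
      · intro x hx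
        simp only [Finset.mem_filter, Fintype.mem_piFinset, Finset.mem_range] at hx ⊢
        constructor
        · intro i
          refine Fin.lastCases ?_ (fun i => ?_) i
          · simpa
          · simpa using hx i
        · simp; omega
      · intro x hx
        simp only [Finset.mem_filter, Fintype.mem_piFinset, Finset.mem_range] at hx ⊢
        exact fun i => hx.1 i.castSucc
      · intro x _
        simp
      · intro x hx
        rw [show p - 1 = x (Fin.last m) by have := (Finset.mem_filter.mp hx).2; omega,
          Fin.snoc_init_self]
      · intro x _
        rw [facetDet_top hL' (τ' := τ') (by simp; omega) (by simp) (by simp), Fin.init_snoc]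

/-- **Kuhn's lemma**: an admissible labelling of a subdivided cube has a fully labelled
simplex. -/
lemma IsKuhnLabel.exists_forall_label {n p : ℕ} (hp : 0 < p) {L : (Fin n → ℕ) → Fin (n + 1)}
    (hL : IsKuhnLabel p L) :
    ∃ x ∈ kuhnBox n p, ∃ τ : Perm (Fin n), ∀ c, ∃ k, L (kuhnVertex x τ k) = c := by
  have h := (sum_simplexDet_eq_one hp hL).trans_ne one_ne_zero
  obtain ⟨x, hx, h⟩ := Finset.exists_ne_zero_of_sum_ne_zero h
  obtain ⟨τ, -, h⟩ := Finset.exists_ne_zero_of_sum_ne_zero h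
  exact ⟨x, hx, τ, exists_label_of_simplexDet_ne_zero h⟩

lemma exists_isKuhnLabel {n p : ℕ} (B : (Fin n → ℕ) → Fin n → Prop)
    (h0 : ∀ x i, x i = 0 → ¬ B x i) (h1 : ∀ x i, x i = p → B x i) :
    ∃ L : (Fin n → ℕ) → Fin (n + 1), IsKuhnLabel p L ∧ (∀ x i, L x = i.castSucc → B x i) ∧
      ∀ x, L x = Fin.last n → ∀ i, ¬ B x i := by
  have key : ∀ x, ∃ c : Fin (n + 1), (∀ i, c = i.castSucc → B x i) ∧
      ∀ i : Fin n, i.castSucc < c → ¬ B x i := by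
    intro x
    by_cases h : {i | B x i}.Nonempty
    · obtain ⟨i, hi, hmin⟩ := wellFounded_lt.has_min {i | B x i} h
      refine ⟨i.castSucc, fun j hj => Fin.castSucc_inj.mp hj ▸ hi, fun j hj hB => ?_⟩
      exact hmin j hB (Fin.castSucc_lt_castSucc_iff.mp hj)
    · refine ⟨Fin.last n, fun i hi => absurd hi.symm (Fin.castSucc_lt_last i).ne, fun i _ hB => ?_⟩
      exact h ⟨i, hB⟩
  choose L hL hlt using key
  refine ⟨L, ⟨fun x i hx h => h0 x i hx (hL x i h), fun x i hx => ?_⟩, hL, fun x hx i => ?_⟩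
  · exact not_lt.mp fun h => hlt x i h (h1 x i hx)
  · exact hlt x i (hx ▸ Fin.castSucc_lt_last i)

open Set Filter Topology

lemma exists_approx_sign_change {n p : ℕ} (hp : 0 < p) {f : (Fin n → ℝ) → Fin n → ℝ}
    (h0 : ∀ u ∈ Icc (0 : Fin n → ℝ) 1, ∀ i, u i = 0 → f u i ≤ 0)
    (h1 : ∀ u ∈ Icc (0 : Fin n → ℝ) 1, ∀ i, u i = 1 → 0 ≤ f u i) :
    ∃ b ∈ Icc (0 : Fin n → ℝ) 1, (∀ i, f b i ≤ 0) ∧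
      ∀ i, ∃ a ∈ Icc (0 : Fin n → ℝ) 1, dist a b ≤ 1 / p ∧ 0 ≤ f a i := by
  have hp' : (0 : ℝ) < p := by exact_mod_cast hp
  set g : (Fin n → ℕ) → Fin n → ℝ := fun x i => x i / p with hg
  obtain ⟨L, hL, hpos, hneg⟩ := exists_isKuhnLabel (p := p)
    (fun x i => x i = p ∨ x i ≠ 0 ∧ 0 < f (g x) i) (fun x i hx => by omega) (fun x i => Or.inl)
  obtain ⟨x, hx, τ, hτ⟩ := hL.exists_forall_label hp
  have hmem : ∀ k, g (kuhnVertex x τ k) ∈ Icc (0 : Fin n → ℝ) 1 := by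
    refine fun k => ⟨fun i => by simp only [hg, Pi.zero_apply]; positivity, fun i => ?_⟩
    have hxi := Finset.mem_range.mp (Fintype.mem_piFinset.mp hx i)
    rw [hg, Pi.one_apply, div_le_one hp', Nat.cast_le, kuhnVertex]
    split_ifs <;> omega
  obtain ⟨k, hk⟩ := hτ (Fin.last n)
  refine ⟨g (kuhnVertex x τ k), hmem k, fun i => ?_, fun i => ?_⟩
  · have h := hneg _ hk i
    push Not at h
    by_cases hz : kuhnVertex x τ k i = 0
    · exact h0 _ (hmem k) i (by simp [hg, hz])
    · exact h.2 hz
  · obtain ⟨l, hl⟩ := hτ i.castSucc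
    refine ⟨g (kuhnVertex x τ l), hmem l, ?_, ?_⟩
    · refine (dist_pi_le_iff (by positivity)).mpr fun j => ?_
      rw [Real.dist_eq, hg, ← sub_div, abs_div, abs_of_pos hp']
      gcongr
      simp only [kuhnVertex]
      split_ifs <;> simp
    · rcases hpos _ i hl with h | h
      · exact h1 _ (hmem l) i (by simp [hg, h, hp'.ne'])
      · exact h.2.le

/-- The **Poincaré–Miranda theorem** on the unit cube. -/
theorem exists_eq_zero_of_sign_on_faces {n : ℕ} {f : (Fin n → ℝ) → Fin n → ℝ}
    (hf : ContinuousOn f (Icc 0 1))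
    (h0 : ∀ u ∈ Icc (0 : Fin n → ℝ) 1, ∀ i, u i = 0 → f u i ≤ 0)
    (h1 : ∀ u ∈ Icc (0 : Fin n → ℝ) 1, ∀ i, u i = 1 → 0 ≤ f u i) :
    ∃ u ∈ Icc (0 : Fin n → ℝ) 1, f u = 0 := by
  choose b hb hfb a ha hab hfa using fun p : ℕ =>
    exists_approx_sign_change p.succ_pos h0 h1
  obtain ⟨u, hu, φ, hφ, hlim⟩ := isCompact_Icc.tendsto_subseq hb
  have hlim' : ∀ i, Tendsto (fun p => a (φ p) i) atTop (𝓝 u) := by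
    intro i
    refine hlim.congr_dist (squeeze_zero (fun _ => dist_nonneg) (fun p => ?_)
      (tendsto_one_div_add_atTop_nhds_zero_nat.comp hφ.tendsto_atTop))
    rw [dist_comm]
    exact_mod_cast hab (φ p) i
  have hcont : ∀ {v : ℕ → Fin n → ℝ}, (∀ p, v p ∈ Icc (0 : Fin n → ℝ) 1) →
      Tendsto v atTop (𝓝 u) → ∀ i, Tendsto (fun p => f (v p) i) atTop (𝓝 (f u i)) :=
    fun hv hvu => tendsto_pi_nhds.mp
      ((hf u hu).tendsto.comp (tendsto_nhdsWithin_iff.mpr ⟨hvu, .of_forall hv⟩))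
  refine ⟨u, hu, funext fun i => le_antisymm ?_ ?_⟩
  · exact le_of_tendsto' (hcont (fun p => hb (φ p)) hlim i) fun p => hfb (φ p) i
  · exact ge_of_tendsto' (hcont (fun p => ha (φ p) i) (hlim' i) i) fun p => hfa (φ p) i

lemma Convex.exists_continuous_retraction_of_isComplete {E : Type*} [NormedAddCommGroup E]
    [InnerProductSpace ℝ E] {K : Set E} (hconv : Convex ℝ K) (hne : K.Nonempty)
    (hK : IsComplete K) : ∃ r : E → K, Continuous r ∧ ∀ x : K, r x = x := by
  choose r hr hmin using exists_norm_eq_iInf_of_complete_convex hne hK hconv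
  have hin : ∀ u, ∀ w ∈ K, inner ℝ (u - r u) (w - r u) ≤ 0 := fun u =>
    (norm_eq_iInf_iff_real_inner_le_zero hconv (hr u)).mp (hmin u)
  have hlip : LipschitzWith 1 r := by
    refine LipschitzWith.mk_one fun u v => ?_
    rw [dist_eq_norm, dist_eq_norm]
    have h1 := hin u (r v) (hr v)
    have h2 := hin v (r u) (hr u)
    have h3 : ‖r u - r v‖ * ‖r u - r v‖ ≤ inner ℝ (u - v) (r u - r v) := by
      rw [← real_inner_self_eq_norm_mul_norm]
      simp only [inner_sub_left, inner_sub_right] at h1 h2 ⊢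
      linarith
    have h4 := h3.trans (real_inner_le_norm _ _)
    rcases (norm_nonneg (r u - r v)).eq_or_lt with h | h
    · rw [← h]
      exact norm_nonneg _
    · exact le_of_mul_le_mul_right h4 h
  refine ⟨fun u => ⟨r u, hr u⟩, hlip.continuous.subtype_mk _, fun x => Subtype.ext ?_⟩
  have h := hin x x x.2
  rwa [real_inner_self_nonpos, sub_eq_zero, eq_comm] at h

lemma Convex.exists_continuous_retraction {d : ℕ} {K : Set (Fin d → ℝ)} (hconv : Convex ℝ K)
    (hne : K.Nonempty) (hK : IsClosed K) :
    ∃ r : (Fin d → ℝ) → K, Continuous r ∧ ∀ x : K, r x = x := by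
  let e := EuclideanSpace.equiv (Fin d) ℝ
  obtain ⟨r, hr, hrx⟩ := Convex.exists_continuous_retraction_of_isComplete
    (K := e ⁻¹' K) (hconv.is_linear_preimage e.toLinearMap.isLinear)
    (hne.preimage e.surjective) (hK.preimage e.continuous).isComplete
  refine ⟨fun x => ⟨e (r (e.symm x)), (r (e.symm x)).2⟩, by fun_prop, fun x => Subtype.ext ?_⟩
  have := hrx ⟨e.symm x, by simp⟩
  simp [this]

/-- Variation of Brouwer's fixed point theorem: if `K ⊆ ℝ^d` is nonempty, compact and
convex, and `R : K × [0,1] → K × ℝ` is continuous with second coordinate `< 0` on the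
bottom `K × {0}` and `> 1` on the top `K × {1}`, then `R` has a fixed point. -/
theorem brouwer_bottom_down_top_up (d : ℕ) (K : Set (Fin d → ℝ))
    (hne : K.Nonempty) (hcomp : IsCompact K) (hconv : Convex ℝ K)
    (R : K × (Set.Icc (0 : ℝ) 1) → K × ℝ) (hR : Continuous R)
    (hbot : ∀ x : K, (R (x, ⟨0, by norm_num⟩)).2 < 0)
    (htop : ∀ x : K, 1 < (R (x, ⟨1, by norm_num⟩)).2) :
    ∃ z : K × (Set.Icc (0 : ℝ) 1), R z = (z.1, (z.2 : ℝ)) := by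
  obtain ⟨r, hr, hrK⟩ := hconv.exists_continuous_retraction hne hcomp.isClosed
  obtain ⟨M, hM⟩ := hcomp.isBounded.exists_norm_le
  have hKM : ∀ (x : K) (i : Fin d), |(x : Fin d → ℝ) i| ≤ M := fun x i =>
    (norm_le_pi_norm (x : Fin d → ℝ) i).trans (hM x x.2)
  let y : (Fin (d + 1) → ℝ) → Fin d → ℝ := fun u i => M * (2 * u i.succ - 1)
  let z : (Fin (d + 1) → ℝ) → K × Icc (0 : ℝ) 1 := fun u =>
    (r (y u), projIcc 0 1 zero_le_one (u 0))
  have hy : Continuous y := by fun_prop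
  have hz : Continuous z := (hr.comp hy).prodMk (continuous_projIcc.comp (continuous_apply 0))
  let f : (Fin (d + 1) → ℝ) → Fin (d + 1) → ℝ := fun u =>
    Fin.cons ((R (z u)).2 - u 0) fun i => y u i - ((R (z u)).1 : Fin d → ℝ) i
  have hf : Continuous f := by
    refine continuous_pi fun i => ?_
    refine Fin.cases ?_ (fun i => ?_) i
    · simp only [f, Fin.cons_zero]
      fun_prop
    · simp only [f, Fin.cons_succ]
      exact ((continuous_apply i).comp hy).sub
        ((continuous_apply i).comp (continuous_subtype_val.comp (hR.comp hz).fst))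
  obtain ⟨u, hu, hfu⟩ := exists_eq_zero_of_sign_on_faces hf.continuousOn
    (fun u _ i => by
      refine Fin.cases (fun h => ?_) (fun i h => ?_) i
      · have := hbot (r (y u))
        simp only [f, z, Fin.cons_zero, h, projIcc_left]
        linarith
      · have := (abs_le.mp (hKM (R (z u)).1 i)).1
        simp only [f, y, Fin.cons_succ, h]
        linarith)
    (fun u _ i => by
      refine Fin.cases (fun h => ?_) (fun i h => ?_) i
      · have := htop (r (y u))
        simp only [f, z, Fin.cons_zero, h, projIcc_right]
        linarith
      · have := (abs_le.mp (hKM (R (z u)).1 i)).2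
        simp only [f, y, Fin.cons_succ, h]
        linarith)
  refine ⟨z u, Prod.ext ?_ ?_⟩
  · have hyu : y u = (R (z u)).1 := funext fun i => by
      have := congrFun hfu i.succ
      simpa only [f, Fin.cons_succ, Pi.zero_apply, sub_eq_zero] using this
    change (R (z u)).1 = r (y u)
    rw [hyu, hrK]
  · have := congrFun hfu 0
    simp only [f, Fin.cons_zero, Pi.zero_apply, sub_eq_zero] at this
    rw [this]
    exact (congrArg Subtype.val (projIcc_of_mem zero_le_one ⟨hu.1 0, hu.2 0⟩)).symm
end

section
/- Let Q = [0,1]^ℕ be the Hilbert cube with the product topology and let R : Q × [0,1] → Q × ℝ be a continuous map such that the second coordinate of R(x,0) is strictly negative for every x ∈ Q and the second coordinate of R(x,1) is strictly greater than 1 for every x ∈ Q. Then R has a fixed point: there exists (x,t) ∈ Q × [0,1] with R(x,t) = (x,t). -/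
open Function Finset

/-- A simplex of the Freudenthal triangulation of the cube `[0, m + 1]ⁿ`: the corner of a unit cube
together with the order in which the coordinates are increased. -/
abbrev GridSimplex (m n : ℕ) : Type := (Fin n → Fin (m + 1)) × Equiv.Perm (Fin n)

namespace GridSimplex

variable {m n : ℕ}

/-- The `k`-th vertex of a simplex; `s.2 i` is the step at which coordinate `i` is increased. -/
def vertex (s : GridSimplex m n) (k : Fin (n + 1)) (i : Fin n) : ℕ :=
  s.1 i + if (s.2 i : ℕ) < k then 1 else 0

/-- The facet opposite to the `k`-th vertex carries every nonzero label. -/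
def FacetFull (l : (Fin n → ℕ) → Fin (n + 1)) (s : GridSimplex m n) (k : Fin (n + 1)) : Prop :=
  ∀ j : Fin n, ∃ i ≠ k, l (s.vertex i) = j.succ

/-- Every label occurs on the simplex. -/
def Rainbow (l : (Fin n → ℕ) → Fin (n + 1)) (s : GridSimplex m n) : Prop :=
  Surjective fun k => l (s.vertex k)

/-- Pass to the simplex on the other side of the facet opposite to the initial vertex
(cyclically in the corner). -/
def shift : GridSimplex m (n + 1) ≃ GridSimplex m (n + 1) where
  toFun s := (s.1 + Pi.single (s.2.symm 0) 1, s.2.trans (Equiv.subRight 1))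
  invFun s := (s.1 - Pi.single (s.2.symm (Fin.last n)) 1, s.2.trans (Equiv.addRight 1))
  left_inv s := by
    ext : 1
    · simp
    · ext; simp
  right_inv s := by
    have : (-1 : Fin (n + 1)) = Fin.last n :=
      (eq_neg_of_add_eq_zero_left (Fin.last_add_one n)).symm
    ext : 1
    · simp [this]
    · ext; simp

/-- Exchange the order of two consecutive coordinates. -/
def swapAt (k : Fin n) (s : GridSimplex m (n + 1)) : GridSimplex m (n + 1) :=
  (s.1, s.2.trans (Equiv.swap k.castSucc k.succ))

/-- The simplex in the cube of one more dimension whose facet opposite to the initial vertex is the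
given simplex, placed in the face where coordinate `0` is maximal. -/
def ontoFace (s : GridSimplex m n) : GridSimplex m (n + 1) :=
  (Fin.cons (Fin.last m) s.1, Equiv.Perm.decomposeFin.symm (0, s.2))

theorem vertex_shift (s : GridSimplex m (n + 1)) (h : s.1 (s.2.symm 0) ≠ Fin.last m)
    (k : Fin (n + 1)) : (shift s).vertex k.castSucc = s.vertex k.succ := by
  ext i
  have hk := k.isLt
  rcases eq_or_ne i (s.2.symm 0) with rfl | hi
  · have : ((s.1 (s.2.symm 0) + 1 : Fin (m + 1)) : ℕ) = s.1 (s.2.symm 0) + 1 :=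
      Fin.val_add_one_of_lt (Fin.lt_last_iff_ne_last.2 h)
    simp [vertex, shift, this]
    omega
  · have h0 : s.2 i ≠ 0 := fun h => hi (by simp [← h])
    have : ((s.2 i - 1 : Fin (n + 1)) : ℕ) = s.2 i - 1 := Fin.val_sub_one_of_ne_zero h0
    have h0' : (s.2 i : ℕ) ≠ 0 := fun h => h0 (Fin.ext h)
    simp [vertex, shift, this, hi]
    split_ifs <;> omega

theorem vertex_shift_of_eq_last (s : GridSimplex m (n + 1)) (h : s.1 (s.2.symm 0) = Fin.last m)
    (k : Fin (n + 1)) : (shift s).vertex k.castSucc (s.2.symm 0) = 0 := by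
  have hk := k.isLt
  have : ((-1 : Fin (n + 1)) : ℕ) = n := by simp
  simp [vertex, shift, h, this]
  omega

theorem vertex_swapAt (k : Fin n) (s : GridSimplex m (n + 1)) {i : Fin (n + 2)}
    (hi : i ≠ k.succ.castSucc) : (swapAt k s).vertex i = s.vertex i := by
  ext j
  have hi' : (i : ℕ) ≠ k + 1 := fun h => hi (Fin.ext (by simpa using h))
  simp only [vertex, swapAt, Equiv.trans_apply, Equiv.swap_apply_def]
  split_ifs <;> simp_all [Fin.ext_iff] <;> omega

theorem vertex_ontoFace (s : GridSimplex m n) (k : Fin (n + 1)) :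
    (ontoFace s).vertex k.succ = Fin.cons (m + 1) (s.vertex k) := by
  ext i
  refine Fin.cases ?_ (fun i => ?_) i
  · simp [vertex, ontoFace]
  · simp [vertex, ontoFace]

theorem swapAt_swapAt (k : Fin n) (s : GridSimplex m (n + 1)) : swapAt k (swapAt k s) = s := by
  ext : 1
  · rfl
  · ext; simp [swapAt]

theorem swapAt_ne (k : Fin n) (s : GridSimplex m (n + 1)) : swapAt k s ≠ s := by
  intro h
  have h2 := congrArg (fun t : GridSimplex m (n + 1) => t.2 (s.2.symm k.castSucc)) h
  simp [swapAt, Fin.ext_iff] at h2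

theorem facetFull_swapAt (l : (Fin (n + 1) → ℕ) → Fin (n + 2)) (k : Fin n)
    (s : GridSimplex m (n + 1)) :
    FacetFull l (swapAt k s) k.succ.castSucc ↔ FacetFull l s k.succ.castSucc := by
  refine forall_congr' fun j => exists_congr fun i => and_congr_right fun hi => ?_
  rw [vertex_swapAt k s hi]

theorem facetFull_zero_iff (l : (Fin n → ℕ) → Fin (n + 1)) (s : GridSimplex m n) :
    FacetFull l s 0 ↔ ∀ j : Fin n, ∃ i : Fin n, l (s.vertex i.succ) = j.succ := by
  refine forall_congr' fun j => ⟨?_, fun ⟨i, hi⟩ => ⟨i.succ, Fin.succ_ne_zero i, hi⟩⟩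
  rintro ⟨i, hi, h⟩
  obtain ⟨i, rfl⟩ := Fin.exists_succ_eq.2 hi
  exact ⟨i, h⟩

theorem facetFull_last_iff (l : (Fin n → ℕ) → Fin (n + 1)) (s : GridSimplex m n) :
    FacetFull l s (Fin.last n) ↔ ∀ j : Fin n, ∃ i : Fin n, l (s.vertex i.castSucc) = j.succ := by
  refine forall_congr' fun j => ⟨?_, fun ⟨i, hi⟩ => ⟨i.castSucc, Fin.castSucc_ne_last i, hi⟩⟩
  rintro ⟨i, hi, h⟩
  obtain ⟨i, rfl⟩ := Fin.exists_castSucc_eq.2 hi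
  exact ⟨i, h⟩

open Classical in
/-- A map between sets of `n + 1` labels is surjective iff the number of points whose omission
leaves all nonzero labels covered is odd. -/
theorem sum_facets_eq (g : Fin (n + 1) → Fin (n + 1)) :
    (∑ k, if ∀ j : Fin n, ∃ i ≠ k, g i = j.succ then (1 : ZMod 2) else 0) =
      if Surjective g then 1 else 0 := by
  split_ifs with hg
  · have hinj := Finite.injective_iff_surjective.2 hg
    obtain ⟨a, ha⟩ := hg 0
    rw [Finset.sum_eq_single a, if_pos]
    · intro j
      obtain ⟨i, hi⟩ := hg j.succ
      refine ⟨i, ?_, hi⟩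
      rintro rfl
      exact Fin.succ_ne_zero j (hi.symm.trans ha)
    · intro k _ hk
      rw [if_neg]
      intro h
      have : g k ≠ 0 := fun h0 => hk (hinj (h0.trans ha.symm))
      obtain ⟨j, hj⟩ := Fin.exists_succ_eq.2 this
      obtain ⟨i, hi, hij⟩ := h j
      exact hi (hinj (hij.trans hj))
    · simp
  · by_cases hs : ∀ j : Fin n, ∃ i, g i = j.succ
    · obtain ⟨a, b, hne, hab⟩ : ∃ a b, a ≠ b ∧ g a = g b := by
        have := mt Finite.injective_iff_surjective.1 hg
        simp only [Injective] at this
        push Not at this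
        obtain ⟨a, b, h, h'⟩ := this
        exact ⟨a, b, h', h⟩
      have h0 : ∀ i, g i ≠ 0 := fun i hi => hg fun y => by
        refine Fin.cases ⟨i, hi⟩ hs y
      have key : ∀ k, (∀ j : Fin n, ∃ i ≠ k, g i = j.succ) ↔ k = a ∨ k = b := by
        intro k
        constructor
        · intro h
          by_contra! hk
          choose f hf hgf using h
          have hfinj : Injective f := fun x y hxy => by
            have := (hgf x).symm.trans ((congrArg g hxy).trans (hgf y))
            exact Fin.succ_injective _ this
          have himg : (Finset.univ.image f) = Finset.univ.erase k := by
            apply Finset.eq_of_subset_of_card_le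
            · intro x hx
              obtain ⟨y, -, rfl⟩ := Finset.mem_image.1 hx
              exact Finset.mem_erase.2 ⟨hf y, Finset.mem_univ _⟩
            · rw [Finset.card_image_of_injective _ hfinj]
              simp
          have hmem : ∀ x, x ≠ k → ∃ y, f y = x := fun x hx => by
            have : x ∈ Finset.univ.image f := by simp [himg, hx]
            simpa using this
          obtain ⟨x, hx⟩ := hmem a hk.1.symm
          obtain ⟨y, hy⟩ := hmem b hk.2.symm
          have hxy : x = y := Fin.succ_injective _ (by rw [← hgf x, ← hgf y, hx, hy, hab])
          exact hne (by rw [← hx, ← hy, hxy])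
        · rintro (rfl | rfl) j
          · obtain ⟨i, hi⟩ := hs j
            by_cases h : i = k
            · exact ⟨b, hne.symm, by rw [← hab, ← h, hi]⟩
            · exact ⟨i, h, hi⟩
          · obtain ⟨i, hi⟩ := hs j
            by_cases h : i = k
            · exact ⟨a, hne, by rw [hab, ← h, hi]⟩
            · exact ⟨i, h, hi⟩
      simp_rw [key]
      rw [← Finset.sum_filter, Finset.filter_or, Finset.filter_eq', Finset.filter_eq']
      simp only [Finset.mem_univ, if_true]
      rw [Finset.sum_union (by simpa using hne)]
      simp only [Finset.sum_singleton]
      decide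
    · push Not at hs
      obtain ⟨j, hj⟩ := hs
      refine Finset.sum_eq_zero fun k _ => if_neg fun h => ?_
      obtain ⟨i, -, hi⟩ := h j
      exact hj i hi

open Classical in
theorem sum_facetFull_mid (l : (Fin (n + 1) → ℕ) → Fin (n + 2)) (k : Fin n) :
    (∑ s : GridSimplex m (n + 1),
      if FacetFull l s k.succ.castSucc then (1 : ZMod 2) else 0) = 0 := by
  refine Finset.sum_involution (fun s _ => swapAt k s) (fun s _ => ?_) (fun s _ _ => swapAt_ne k s)
    (fun s _ => Finset.mem_univ _) (fun s _ => swapAt_swapAt k s)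
  simp only [facetFull_swapAt]
  exact CharTwo.add_self_eq_zero _

open Classical in
theorem sum_facetFull_zero (l : (Fin (n + 1) → ℕ) → Fin (n + 2))
    (h0 : ∀ v j, v j = 0 → l v ≠ j.succ) :
    (∑ s : GridSimplex m (n + 1), if FacetFull l s 0 then (1 : ZMod 2) else 0) =
      (∑ s : GridSimplex m (n + 1),
        if FacetFull l s 0 ∧ s.1 (s.2.symm 0) = Fin.last m then (1 : ZMod 2) else 0) +
      ∑ s : GridSimplex m (n + 1), if FacetFull l s (Fin.last _) then (1 : ZMod 2) else 0 := by
  rw [← Equiv.sum_comp shift fun s : GridSimplex m (n + 1) =>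
    if FacetFull l s (Fin.last _) then (1 : ZMod 2) else 0, ← Finset.sum_add_distrib]
  refine Finset.sum_congr rfl fun s _ => ?_
  by_cases h : s.1 (s.2.symm 0) = Fin.last m
  · have : ¬ FacetFull l (shift s) (Fin.last _) := by
      rw [facetFull_last_iff]
      intro hf
      obtain ⟨i, hi⟩ := hf (s.2.symm 0)
      exact h0 _ _ (vertex_shift_of_eq_last s h i) hi
    simp [h, this]
  · have : FacetFull l (shift s) (Fin.last _) ↔ FacetFull l s 0 := by
      simp only [facetFull_last_iff, facetFull_zero_iff, vertex_shift s h]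
    simp [h, this]

theorem ontoFace_injective : Injective (ontoFace : GridSimplex m n → GridSimplex m (n + 1)) := by
  intro s t h
  have h1 := congrArg Prod.fst h
  have h2 := Equiv.Perm.decomposeFin.symm.injective (congrArg Prod.snd h)
  exact Prod.ext (Fin.cons_right_injective (α := fun _ => Fin (m + 1)) _ h1) (Prod.ext_iff.1 h2).2

theorem exists_ontoFace_eq (s : GridSimplex m (n + 1)) (h1 : s.2 0 = 0)
    (h2 : s.1 0 = Fin.last m) : ∃ t : GridSimplex m n, ontoFace t = s := by
  refine ⟨(Fin.tail s.1, (Equiv.Perm.decomposeFin s.2).2), Prod.ext ?_ ?_⟩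
  · simp [ontoFace, ← h2]
  · have : (Equiv.Perm.decomposeFin s.2).1 = 0 := by
      rw [← h1]
      conv_rhs => rw [← Equiv.Perm.decomposeFin.symm_apply_apply s.2]
      rw [← Prod.mk.eta (p := Equiv.Perm.decomposeFin s.2),
        Equiv.Perm.decomposeFin_symm_apply_zero]
    simp only [ontoFace]
    rw [← this, Prod.mk.eta, Equiv.symm_apply_apply]

open Classical in
/-- Sperner's lemma for the cube: the number of rainbow simplices is odd. -/
theorem sum_rainbow (l : (Fin n → ℕ) → Fin (n + 1))
    (h0 : ∀ v j, v j = 0 → l v ≠ j.succ) (h1 : ∀ v j, v j = m + 1 → j.succ ≤ l v) :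
    (∑ s : GridSimplex m n, if Rainbow l s then (1 : ZMod 2) else 0) = 1 := by
  induction n with
  | zero =>
    have : ∀ s : GridSimplex m 0, Rainbow l s := fun s y => ⟨0, Subsingleton.elim (α := Fin 1) _ _⟩
    simp [this]
  | succ n ih =>
    have hl : ∀ w : Fin n → ℕ, l (Fin.cons (m + 1) w) ≠ 0 := fun w h => by
      have := h1 (Fin.cons (m + 1) w) 0 rfl
      rw [h] at this
      exact absurd this (by simp)
    let l' : (Fin n → ℕ) → Fin (n + 1) := fun w => (l (Fin.cons (m + 1) w)).pred (hl w)
    have hl' : ∀ w, l (Fin.cons (m + 1) w) = (l' w).succ := fun w => (Fin.succ_pred _ _).symm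
    have hface := ih l'
      (fun v j hv h => h0 (Fin.cons (m + 1) v) j.succ hv (by rw [hl', h]))
      (fun v j hv => by
        have := h1 (Fin.cons (m + 1) v) j.succ hv
        rwa [hl', Fin.succ_le_succ_iff] at this)
    have hrainbow : ∀ s : GridSimplex m (n + 1),
        (if Rainbow l s then (1 : ZMod 2) else 0) =
          ∑ k, if FacetFull l s k then (1 : ZMod 2) else 0 := fun s => by
      convert (sum_facets_eq fun k => l (s.vertex k)).symm <;> rfl
    simp_rw [hrainbow]
    rw [Finset.sum_comm, Fin.sum_univ_succ, Fin.sum_univ_castSucc]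
    simp only [← Fin.castSucc_succ, sum_facetFull_mid, Finset.sum_const_zero,
      zero_add, Fin.succ_last]
    rw [sum_facetFull_zero l h0, add_assoc, CharTwo.add_self_eq_zero, add_zero]
    refine Eq.trans (Eq.symm ?_) hface
    have hfull : ∀ s : GridSimplex m n, FacetFull l (ontoFace s) 0 ↔ Rainbow l' s := fun s => by
      rw [facetFull_zero_iff]
      simp only [vertex_ontoFace, hl', Fin.succ_inj]
      rfl
    refine Finset.sum_of_injOn ontoFace ontoFace_injective.injOn (by simp) ?_ ?_
    · intro s _ hs
      refine if_neg fun ⟨hf, hlast⟩ => hs ?_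
      rw [facetFull_zero_iff] at hf
      have hmax : ∀ i : Fin (n + 1), s.vertex i.succ (s.2.symm 0) = m + 1 := fun i => by
        simp [vertex, hlast]
      obtain ⟨i, hi⟩ := hf 0
      have hp : s.2.symm 0 = 0 := by
        have := h1 _ _ (hmax i)
        rw [hi, Fin.succ_le_succ_iff] at this
        exact Fin.le_zero_iff.1 this
      obtain ⟨t, ht⟩ := exists_ontoFace_eq s ((Equiv.symm_apply_eq _).1 hp).symm
        (by rwa [hp] at hlast)
      exact ⟨t, by simp, ht⟩
    · intro s _
      have : (ontoFace s).1 ((ontoFace s).2.symm 0) = Fin.last m := by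
        have h2 : (ontoFace s).2 0 = 0 := by simp [ontoFace]
        rw [(Equiv.symm_apply_eq _).2 h2.symm]
        rfl
      simp only [hfull, this, and_true]

theorem exists_rainbow (m : ℕ) (l : (Fin n → ℕ) → Fin (n + 1))
    (h0 : ∀ v j, v j = 0 → l v ≠ j.succ) (h1 : ∀ v j, v j = m + 1 → j.succ ≤ l v) :
    ∃ s : GridSimplex m n, Rainbow l s := by
  classical
  by_contra! h
  have := sum_rainbow (m := m) l h0 h1
  simp [h] at this

theorem abs_vertex_sub_vertex_le (s : GridSimplex m n) (j k : Fin (n + 1)) (i : Fin n) :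
    |(s.vertex j i : ℝ) - s.vertex k i| ≤ 1 := by
  simp only [vertex]
  split_ifs <;> simp

end GridSimplex

open unitInterval

/-- The Poincaré–Miranda theorem, up to an error `ε`. -/
theorem exists_forall_abs_le {n : ℕ} {h : (Fin n → I) → Fin n → ℝ} (hc : Continuous h)
    (h0 : ∀ x i, x i = 0 → 0 ≤ h x i) (h1 : ∀ x i, x i = 1 → h x i ≤ 0) {ε : ℝ} (hε : 0 < ε) :
    ∃ x, ∀ i, |h x i| ≤ ε := by
  classical
  obtain ⟨δ, hδ, hu⟩ := Metric.uniformContinuous_iff.1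
    (CompactSpace.uniformContinuous_of_continuous hc) ε hε
  obtain ⟨m, hm⟩ := exists_nat_one_div_lt hδ
  have hm0 : (0 : ℝ) < m + 1 := by positivity
  let p : (Fin n → ℕ) → Fin n → I := fun v i =>
    Set.projIcc 0 1 zero_le_one ((v i : ℝ) / (m + 1))
  have hp0 : ∀ v i, v i = 0 → p v i = 0 := fun v i hv => by
    simp [p, hv, Set.projIcc_left]
  have hp1 : ∀ v i, v i = m + 1 → p v i = 1 := fun v i hv => by
    simp [p, hv, div_self hm0.ne', Set.projIcc_right]
  let P : (Fin n → ℕ) → Fin n → Prop := fun v i => p v i ≠ 0 ∧ (p v i = 1 ∨ h (p v) i ≤ 0)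
  let l : (Fin n → ℕ) → Fin (n + 1) := fun v => (univ.filter (P v)).sup Fin.succ
  have hPle : ∀ v i, P v i → i.succ ≤ l v := fun v i hi =>
    Finset.le_sup (f := Fin.succ) (Finset.mem_filter.2 ⟨Finset.mem_univ i, hi⟩)
  have hlP : ∀ v i, l v = i.succ → P v i := fun v i hi => by
    rcases (univ.filter (P v)).eq_empty_or_nonempty with he | hne
    · have : l v = 0 := by simp only [l, he]; rfl
      exact absurd (hi.symm.trans this) (Fin.succ_ne_zero i)
    · obtain ⟨j, hj, hjl⟩ := Finset.exists_mem_eq_sup _ hne Fin.succ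
      have : i = j := Fin.succ_injective _ (hi.symm.trans hjl)
      rw [this]
      exact (Finset.mem_filter.1 hj).2
  obtain ⟨s, hs⟩ := GridSimplex.exists_rainbow m l
    (fun v j hv hl => (hlP v j hl).1 (hp0 v j hv))
    (fun v j hv => hPle v j ⟨by simp [hp1 v j hv], Or.inl (hp1 v j hv)⟩)
  have hclose : ∀ j k, dist (h (p (s.vertex j))) (h (p (s.vertex k))) < ε := fun j k => by
    refine hu (((dist_pi_le_iff (by positivity)).2 fun i => ?_).trans_lt hm)
    rw [Subtype.dist_eq, Real.dist_eq]
    refine (Set.abs_projIcc_sub_projIcc zero_le_one).trans ?_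
    rw [← sub_div, abs_div, abs_of_pos hm0]
    gcongr
    exact GridSimplex.abs_vertex_sub_vertex_le s j k i
  obtain ⟨k, hk⟩ := hs 0
  refine ⟨p (s.vertex k), fun i => ?_⟩
  have hpos : 0 ≤ h (p (s.vertex k)) i := by
    have hnP : ¬ P (s.vertex k) i := fun hP => by
      have := hPle _ _ hP
      rw [show l (s.vertex k) = 0 from hk] at this
      exact absurd this (by simp)
    by_cases hz : p (s.vertex k) i = 0
    · exact h0 _ _ hz
    · by_contra! hneg
      exact hnP ⟨hz, Or.inr hneg.le⟩
  obtain ⟨j, hj⟩ := hs i.succ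
  have hneg : h (p (s.vertex j)) i ≤ 0 := (hlP _ _ hj).2.elim (h1 _ _) id
  have hd := (dist_le_pi_dist _ _ i).trans (hclose k j).le
  rw [Real.dist_eq] at hd
  rw [abs_of_nonneg hpos]
  linarith [le_abs_self (h (p (s.vertex k)) i - h (p (s.vertex j)) i)]

/-- The Poincaré–Miranda theorem. -/
theorem exists_eq_zero_of_boundary_signs {n : ℕ} {h : (Fin n → I) → Fin n → ℝ}
    (hc : Continuous h) (h0 : ∀ x i, x i = 0 → 0 ≤ h x i) (h1 : ∀ x i, x i = 1 → h x i ≤ 0) :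
    ∃ x, h x = 0 := by
  obtain ⟨x, -, hx⟩ := isCompact_univ.exists_isMinOn Set.univ_nonempty hc.norm.continuousOn
  refine ⟨x, norm_le_zero_iff.1 (le_of_forall_pos_le_add fun ε hε => ?_)⟩
  obtain ⟨y, hy⟩ := exists_forall_abs_le hc h0 h1 hε
  rw [zero_add]
  exact (hx (Set.mem_univ y)).trans ((pi_norm_le_iff_of_nonneg hε.le).2 hy)

/-- Finitely many coordinates of a self-map of the Hilbert cube, together with the additional
coordinate, can be fixed simultaneously. -/
theorem exists_fixed_coordinates (R : (ℕ → I) × I → (ℕ → I) × ℝ) (hR : Continuous R)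
    (hbot : ∀ x, (R (x, 0)).2 ≤ 0) (htop : ∀ x, 1 ≤ (R (x, 1)).2) (n : ℕ) :
    ∃ z, (R z).2 = z.2 ∧ ∀ k < n, (R z).1 k = z.1 k := by
  let e : (Fin (n + 1) → I) → (ℕ → I) × I := fun y =>
    (fun k => if hk : k < n then y (Fin.succ ⟨k, hk⟩) else 0, y 0)
  have he : Continuous e := by
    refine Continuous.prodMk (continuous_pi fun k => ?_) (continuous_apply 0)
    by_cases hk : k < n
    · simpa [hk] using continuous_apply _
    · simpa [hk] using continuous_const
  let h : (Fin (n + 1) → I) → Fin (n + 1) → ℝ := fun y =>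
    Fin.cons ((y 0 : ℝ) - (R (e y)).2) fun i => ((R (e y)).1 i : ℝ) - y i.succ
  have hc : Continuous h := by
    refine continuous_pi fun i => Fin.cases ?_ (fun i => ?_) i
    · simp only [h, Fin.cons_zero]
      fun_prop
    · simp only [h, Fin.cons_succ]
      fun_prop
  obtain ⟨y, hy⟩ := exists_eq_zero_of_boundary_signs hc
    (fun y i => Fin.cases (fun hy => by
      have := hbot (e y).1
      simp only [h, Fin.cons_zero, hy, Set.Icc.coe_zero]
      rw [show e y = ((e y).1, 0) from Prod.ext rfl hy]
      linarith) (fun i hy => by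
      simp only [h, Fin.cons_succ, hy, Set.Icc.coe_zero, sub_zero]
      exact nonneg _) i)
    (fun y i => Fin.cases (fun hy => by
      have := htop (e y).1
      simp only [h, Fin.cons_zero, hy, Set.Icc.coe_one]
      rw [show e y = ((e y).1, 1) from Prod.ext rfl hy]
      linarith) (fun i hy => by
      simp only [h, Fin.cons_succ, hy, Set.Icc.coe_one]
      linarith [le_one ((R (e y)).1 i)]) i)
  refine ⟨e y, ?_, fun k hk => ?_⟩
  · have := congrFun hy 0
    simp only [h, Fin.cons_zero, Pi.zero_apply] at this
    exact (sub_eq_zero.1 this).symm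
  · have := congrFun hy (Fin.succ ⟨k, hk⟩)
    simp only [h, Fin.cons_succ, Pi.zero_apply] at this
    have hek : (e y).1 k = y (Fin.succ ⟨k, hk⟩) := by simp [e, hk]
    rw [hek]
    exact Subtype.ext (sub_eq_zero.1 this)

/-- Hilbert-cube version of the variation of Brouwer's fixed point theorem: if
`Q = [0,1]^ℕ` is the Hilbert cube (with the product topology) and
`R : Q × [0,1] → Q × ℝ` is continuous with second coordinate `< 0` on the bottom
`Q × {0}` and `> 1` on the top `Q × {1}`, then `R` has a fixed point. -/
theorem hilbert_cube_bottom_down_top_up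
    (R : (ℕ → Set.Icc (0 : ℝ) 1) × (Set.Icc (0 : ℝ) 1) →
         (ℕ → Set.Icc (0 : ℝ) 1) × ℝ)
    (hR : Continuous R)
    (hbot : ∀ x : ℕ → Set.Icc (0 : ℝ) 1, (R (x, ⟨0, by norm_num⟩)).2 < 0)
    (htop : ∀ x : ℕ → Set.Icc (0 : ℝ) 1, (R (x, ⟨1, by norm_num⟩)).2 > 1) :
    ∃ z : (ℕ → Set.Icc (0 : ℝ) 1) × (Set.Icc (0 : ℝ) 1),
      R z = (z.1, (z.2 : ℝ)) := by
  let C : ℕ → Set ((ℕ → I) × I) := fun n => {z | (R z).2 = z.2 ∧ ∀ k < n, (R z).1 k = z.1 k}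
  have hclosed : ∀ n, IsClosed (C n) := fun n => by
    simp only [C, Set.ofPred_and, Set.ofPred_forall]
    exact (isClosed_eq (by fun_prop) (by fun_prop)).inter
      (isClosed_iInter fun k => isClosed_iInter fun _ => isClosed_eq (by fun_prop) (by fun_prop))
  obtain ⟨z, hz⟩ := IsCompact.nonempty_iInter_of_sequence_nonempty_isCompact_isClosed C
    (fun n z hz => ⟨hz.1, fun k hk => hz.2 k (hk.trans n.lt_succ_self)⟩)
    (exists_fixed_coordinates R hR (fun x => (hbot x).le) fun x => (htop x).le)
    (hclosed 0).isCompact hclosed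
  rw [Set.mem_iInter] at hz
  exact ⟨z, Prod.ext (funext fun k => (hz (k + 1)).2 k k.lt_succ_self) (hz 0).1⟩
end

section
/- The nonlinearity map is a bijection between orientation-preserving C² diffeomorphisms of [-1,1] fixing the endpoints and continuous functions on [-1,1]: for every continuous function η : [-1,1] → ℝ there exists a unique map φ : [-1,1] → [-1,1] which is C² with continuous second derivative, satisfies φ(-1) = -1, φ(1) = 1, φ' > 0, and φ''/φ' = η; explicitly, φ(x) = -1 + 2·(∫_{-1}^x exp(∫_{-1}^s η(u) du) ds)/(∫_{-1}^1 exp(∫_{-1}^s η(u) du) ds). -/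
/-- `IsDiffeo φ d1 d2` : `φ` is an orientation-preserving C² diffeomorphism of `[-1,1]`
onto itself fixing the endpoints, with first derivative `d1 > 0` and continuous second
derivative `d2`. -/
def IsDiffeo (φ d1 d2 : ℝ → ℝ) : Prop :=
  Set.BijOn φ (Set.Icc (-1 : ℝ) 1) (Set.Icc (-1 : ℝ) 1) ∧
  φ (-1) = -1 ∧ φ 1 = 1 ∧
  (∀ x ∈ Set.Icc (-1 : ℝ) 1, HasDerivWithinAt φ (d1 x) (Set.Icc (-1 : ℝ) 1) x) ∧
  (∀ x ∈ Set.Icc (-1 : ℝ) 1, HasDerivWithinAt d1 (d2 x) (Set.Icc (-1 : ℝ) 1) x) ∧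
  ContinuousOn d2 (Set.Icc (-1 : ℝ) 1) ∧
  (∀ x ∈ Set.Icc (-1 : ℝ) 1, 0 < d1 x)

open Set in
/-- A function with vanishing derivative within `[a, b]` is constant there. -/
lemma eq_left_of_hasDerivWithinAt_zero {f : ℝ → ℝ} {a b : ℝ}
    (hf : ∀ x ∈ Icc a b, HasDerivWithinAt f 0 (Icc a b) x) {x : ℝ} (hx : x ∈ Icc a b) :
    f x = f a := by
  refine constant_of_derivWithin_zero (fun y hy => (hf y hy).differentiableWithinAt)
    (fun y hy => ?_) x hx
  exact (hf y (Ico_subset_Icc_self hy)).derivWithin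
    (uniqueDiffOn_Icc (hy.1.trans_lt hy.2) y (Ico_subset_Icc_self hy))

/-- If `h' = e` and `F' = exp h`, then every `C²` function `φ` on `[a, b]` with `φ'' = e φ'` is an
affine function of `F`. -/
lemma eq_affine_of_hasDerivWithinAt_mul {φ d e h F : ℝ → ℝ} {a b : ℝ}
    (hφ : ∀ x ∈ Set.Icc a b, HasDerivWithinAt φ (d x) (Set.Icc a b) x)
    (hd : ∀ x ∈ Set.Icc a b, HasDerivWithinAt d (e x * d x) (Set.Icc a b) x)
    (hh : ∀ x, HasDerivAt h (e x) x) (hF : ∀ x, HasDerivAt F (Real.exp (h x)) x) :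
    ∃ c, ∀ x ∈ Set.Icc a b, φ x = φ a + c * (F x - F a) := by
  have hconst : ∀ x ∈ Set.Icc a b, d x * Real.exp (-h x) = d a * Real.exp (-h a) := by
    intro x hx
    refine eq_left_of_hasDerivWithinAt_zero (f := fun y => d y * Real.exp (-h y)) ?_ hx
    intro y hy
    exact ((hd y hy).mul (hh y).neg.exp.hasDerivWithinAt).congr_deriv (by
      simp only [Pi.neg_apply]
      ring)
  refine ⟨d a * Real.exp (-h a), fun x hx => ?_⟩
  have key : φ x - d a * Real.exp (-h a) * F x = φ a - d a * Real.exp (-h a) * F a := by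
    refine eq_left_of_hasDerivWithinAt_zero
      (f := fun y => φ y - d a * Real.exp (-h a) * F y) ?_ hx
    intro y hy
    refine ((hφ y hy).sub
      ((hF y).const_mul (d a * Real.exp (-h a))).hasDerivWithinAt).congr_deriv ?_
    rw [← hconst y hy, mul_assoc, ← Real.exp_add]
    simp
  linarith

/-- The nonlinearity `Nφ = φ''/φ'` is a bijection between orientation-preserving C²
diffeomorphisms of `[-1,1]` fixing the endpoints and continuous functions on `[-1,1]`:
for every continuous `η` there is a φ with `Nφ = η`, given by the explicit formula
`φ(x) = -1 + 2 (∫_{-1}^x exp(∫_{-1}^s η)) / (∫_{-1}^1 exp(∫_{-1}^s η))`,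
and any two such diffeomorphisms agree on `[-1,1]`. -/
theorem nonlinearity_bijection (η : ℝ → ℝ) (hη : ContinuousOn η (Set.Icc (-1 : ℝ) 1)) :
    (∃ φ d1 d2 : ℝ → ℝ, IsDiffeo φ d1 d2 ∧
      (∀ x ∈ Set.Icc (-1 : ℝ) 1, d2 x = η x * d1 x) ∧
      (∀ x ∈ Set.Icc (-1 : ℝ) 1,
        φ x = -1 + 2 * (∫ s in (-1 : ℝ)..x, Real.exp (∫ u in (-1 : ℝ)..s, η u)) /
          (∫ s in (-1 : ℝ)..(1 : ℝ), Real.exp (∫ u in (-1 : ℝ)..s, η u)))) ∧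
    (∀ φ₁ d1₁ d2₁ φ₂ d1₂ d2₂ : ℝ → ℝ,
      IsDiffeo φ₁ d1₁ d2₁ → (∀ x ∈ Set.Icc (-1 : ℝ) 1, d2₁ x = η x * d1₁ x) →
      IsDiffeo φ₂ d1₂ d2₂ → (∀ x ∈ Set.Icc (-1 : ℝ) 1, d2₂ x = η x * d1₂ x) →
      ∀ x ∈ Set.Icc (-1 : ℝ) 1, φ₁ x = φ₂ x) := by
  have hle : (-1 : ℝ) ≤ 1 := by norm_num
  set I : Set ℝ := Set.Icc (-1 : ℝ) 1
  have hmem : (-1 : ℝ) ∈ I := Set.left_mem_Icc.2 hle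
  have hmem' : (1 : ℝ) ∈ I := Set.right_mem_Icc.2 hle
  have hsub : ∀ x ∈ I, Set.uIcc (-1) x ⊆ I := fun x hx => by
    rw [Set.uIcc_of_le hx.1]
    exact Set.Icc_subset_Icc_right hx.2
  let e : ℝ → ℝ := Set.IccExtend hle (I.domRestrict η)
  have he : Continuous e := (continuousOn_iff_continuous_domRestrict.1 hη).Icc_extend'
  have heη : ∀ x ∈ I, e x = η x := fun x hx => Set.IccExtend_of_mem hle _ hx
  let h : ℝ → ℝ := fun s => ∫ u in (-1 : ℝ)..s, e u
  have hh : ∀ x, HasDerivAt h (e x) x := fun x => he.integral_hasStrictDerivAt _ x |>.hasDerivAt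
  have hhη : ∀ s ∈ I, h s = ∫ u in (-1 : ℝ)..s, η u := fun s hs =>
    intervalIntegral.integral_congr fun u hu => heη u (hsub s hs hu)
  have hexp : Continuous fun x => Real.exp (h x) :=
    Real.continuous_exp.comp (continuous_iff_continuousAt.2 fun x => (hh x).continuousAt)
  let F : ℝ → ℝ := fun x => ∫ s in (-1 : ℝ)..x, Real.exp (h s)
  have hF : ∀ x, HasDerivAt F (Real.exp (h x)) x :=
    fun x => hexp.integral_hasStrictDerivAt _ x |>.hasDerivAt
  have hFη : ∀ x ∈ I, F x = ∫ s in (-1 : ℝ)..x, Real.exp (∫ u in (-1 : ℝ)..s, η u) :=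
    fun x hx => intervalIntegral.integral_congr fun s hs => by
      simp only [hhη s (hsub x hx hs)]
  have hF0 : F (-1) = 0 := intervalIntegral.integral_same
  have hFmono : StrictMono F := strictMono_of_hasDerivAt_pos hF fun x => Real.exp_pos _
  have hF1 : 0 < F 1 := hF0 ▸ hFmono (by norm_num)
  constructor
  · let c : ℝ := 2 / F 1
    have hc : 0 < c := by positivity
    let φ : ℝ → ℝ := fun x => -1 + c * F x
    have hφ : ∀ x, HasDerivAt φ (c * Real.exp (h x)) x :=
      fun x => ((hF x).const_mul c).const_add (-1)
    have hφmono : StrictMono φ := fun x y hxy => by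
      have := mul_lt_mul_of_pos_left (hFmono hxy) hc
      simp only [φ]
      linarith
    have hφ0 : φ (-1) = -1 := by simp [φ, hF0]
    have hφ1 : φ 1 = 1 := by
      simp only [φ, c]
      field_simp
      norm_num
    have hd : ∀ x, HasDerivAt (fun x => c * Real.exp (h x)) (e x * (c * Real.exp (h x))) x :=
      fun x => ((hh x).exp.const_mul c).congr_deriv (by ring)
    refine ⟨φ, fun x => c * Real.exp (h x), fun x => e x * (c * Real.exp (h x)),
      ⟨⟨fun x hx => ?_, hφmono.injective.injOn, ?_⟩, hφ0, hφ1,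
        fun x _ => (hφ x).hasDerivWithinAt, fun x _ => (hd x).hasDerivWithinAt,
        (he.mul (continuous_const.mul hexp)).continuousOn,
        fun x _ => mul_pos hc (Real.exp_pos _)⟩, fun x hx => ?_, fun x hx => ?_⟩
    · exact ⟨hφ0 ▸ hφmono.monotone hx.1, (hφmono.monotone hx.2).trans_eq hφ1⟩
    · have := intermediate_value_Icc hle fun x _ => (hφ x).continuousAt.continuousWithinAt
      rwa [hφ0, hφ1] at this
    · simp only [heη x hx]
    · rw [← hFη x hx, ← hFη 1 hmem']
      simp only [φ, c]
      ring
  · have huniq : ∀ φ d1 d2 : ℝ → ℝ, IsDiffeo φ d1 d2 → (∀ x ∈ I, d2 x = η x * d1 x) →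
        ∀ x ∈ I, φ x = -1 + 2 / F 1 * F x := by
      rintro φ d1 d2 ⟨-, h0, h1, hφ, hd, -, -⟩ hη' x hx
      obtain ⟨c, hc⟩ := eq_affine_of_hasDerivWithinAt_mul hφ
        (fun y hy => by rw [heη y hy, ← hη' y hy]; exact hd y hy) hh hF
      have hc1 := hc 1 hmem'
      rw [h0, h1, hF0] at hc1
      rw [hc x hx, h0, hF0, sub_zero, show c = 2 / F 1 by rw [eq_div_iff hF1.ne']; linarith]
    intro φ₁ d1₁ d2₁ φ₂ d1₂ d2₂ H₁ hη₁ H₂ hη₂ x hx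
    rw [huniq _ _ _ H₁ hη₁ x hx, huniq _ _ _ H₂ hη₂ x hx]
end

section
/- Decompositions with summable nonlinearity can be composed: let (φ_n)_{n≥0} be a sequence of C² diffeomorphisms of [-1,1] onto itself, each with φ_n(-1) = -1, φ_n(1) = 1 and φ_n' > 0, and suppose S = Σ_{n≥0} sup_{x∈[-1,1]} |φ_n''(x)/φ_n'(x)| < ∞. Then the partial compositions Ψ_n = φ_0 ∘ φ_1 ∘ ⋯ ∘ φ_n converge uniformly on [-1,1] to a homeomorphism Ψ of [-1,1] onto itself with Ψ(-1) = -1 and Ψ(1) = 1, and Ψ is bi-Lipschitz with exp(-2S) ≤ (Ψ(x) - Ψ(y))/(x - y) ≤ exp(2S) for all x ≠ y in [-1,1]. -/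
/-- The partial compositions `Ψ_n = φ_0 ∘ φ_1 ∘ ⋯ ∘ φ_n` of a sequence of maps. -/
def partialComp (φ : ℕ → ℝ → ℝ) : ℕ → ℝ → ℝ
  | 0 => φ 0
  | n + 1 => partialComp φ n ∘ φ (n + 1)

open Set Filter Topology

/-- The sup-norm on `[-1,1]` of the nonlinearity of a map with derivatives `d1`, `d2`. -/
noncomputable def nonlinNorm (d1 d2 : ℝ → ℝ) : ℝ :=
  sSup ((fun x => |d2 x / d1 x|) '' Icc (-1 : ℝ) 1)

/-- Difference quotients of `f` on `[-1,1]` lie between `exp (-2 * s)` and `exp (2 * s)`. -/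
def ExpBound (f : ℝ → ℝ) (s : ℝ) : Prop :=
  ∀ x ∈ Icc (-1 : ℝ) 1, ∀ y ∈ Icc (-1 : ℝ) 1, y ≤ x →
    Real.exp (-2 * s) * (x - y) ≤ f x - f y ∧ f x - f y ≤ Real.exp (2 * s) * (x - y)

lemma nonlinNorm_nonneg (d1 d2 : ℝ → ℝ) : 0 ≤ nonlinNorm d1 d2 := by
  apply Real.sSup_nonneg
  rintro _ ⟨x, _, rfl⟩
  exact abs_nonneg _

namespace IsDiffeo

variable {φ d1 d2 : ℝ → ℝ}

lemma abs_div_le_nonlinNorm (h : IsDiffeo φ d1 d2) {x : ℝ} (hx : x ∈ Icc (-1 : ℝ) 1) :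
    |d2 x / d1 x| ≤ nonlinNorm d1 d2 := by
  obtain ⟨-, -, -, -, h2, hc, hpos⟩ := h
  have hc1 : ContinuousOn d1 (Icc (-1 : ℝ) 1) := fun x hx => (h2 x hx).continuousWithinAt
  have hcont : ContinuousOn (fun x => |d2 x / d1 x|) (Icc (-1 : ℝ) 1) :=
    (hc.div hc1 fun x hx => (hpos x hx).ne').abs
  exact le_csSup (isCompact_Icc.image_of_continuousOn hcont).bddAbove (mem_image_of_mem _ hx)

lemma exists_deriv_eq (h : IsDiffeo φ d1 d2) {x y : ℝ} (hx : x ∈ Icc (-1 : ℝ) 1)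
    (hy : y ∈ Icc (-1 : ℝ) 1) (hyx : y < x) :
    ∃ c ∈ Icc (-1 : ℝ) 1, φ x - φ y = d1 c * (x - y) := by
  obtain ⟨-, -, -, h1, -, -, -⟩ := h
  have hsub : Icc y x ⊆ Icc (-1 : ℝ) 1 := Icc_subset_Icc hy.1 hx.2
  obtain ⟨c, hc, hcd⟩ := exists_hasDerivAt_eq_slope φ d1 hyx
    (fun z hz => ((h1 z (hsub hz)).continuousWithinAt).mono hsub)
    (fun z hz => (h1 z (hsub (Ioo_subset_Icc_self hz))).hasDerivAt
      (Icc_mem_nhds (hy.1.trans_lt hz.1) (hz.2.trans_le hx.2)))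
  refine ⟨c, hsub (Ioo_subset_Icc_self hc), ?_⟩
  rw [hcd, div_mul_cancel₀ _ (sub_pos.2 hyx).ne']

lemma abs_log_deriv_le (h : IsDiffeo φ d1 d2) {x : ℝ} (hx : x ∈ Icc (-1 : ℝ) 1) :
    |Real.log (d1 x)| ≤ 2 * nonlinNorm d1 d2 := by
  obtain ⟨c, hc, hcd⟩ := h.exists_deriv_eq (x := 1) (y := -1) (by simp) (by simp) (by norm_num)
  have hc1 : d1 c = 1 := by
    rw [h.2.1, h.2.2.1] at hcd
    linarith
  have key := (convex_Icc (-1 : ℝ) 1).norm_image_sub_le_of_norm_hasDerivWithin_le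
    (f := fun z => Real.log (d1 z)) (f' := fun z => d2 z / d1 z)
    (fun z hz => (h.2.2.2.2.1 z hz).log (h.2.2.2.2.2.2 z hz).ne')
    (fun z hz => h.abs_div_le_nonlinNorm hz) hc hx
  simp only [hc1, Real.log_one, sub_zero, Real.norm_eq_abs] at key
  have hd : |x - c| ≤ 2 := abs_le.2 ⟨by linarith [hx.1, hc.2], by linarith [hx.2, hc.1]⟩
  nlinarith [nonlinNorm_nonneg d1 d2]

lemma expBound (h : IsDiffeo φ d1 d2) : ExpBound φ (nonlinNorm d1 d2) := by
  intro x hx y hy hyx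
  rcases hyx.eq_or_lt with rfl | hlt
  · simp
  obtain ⟨c, hc, hcd⟩ := h.exists_deriv_eq hx hy hlt
  have hpos := h.2.2.2.2.2.2 c hc
  have hl := abs_le.1 (h.abs_log_deriv_le hc)
  have hxy := sub_nonneg.2 hyx
  rw [hcd]
  constructor
  · refine mul_le_mul_of_nonneg_right ?_ hxy
    rw [← Real.le_log_iff_exp_le hpos]
    linarith [hl.1]
  · refine mul_le_mul_of_nonneg_right ?_ hxy
    rw [← Real.log_le_iff_le_exp hpos]
    exact hl.2

lemma abs_sub_self_le (h : IsDiffeo φ d1 d2) {x : ℝ} (hx : x ∈ Icc (-1 : ℝ) 1) :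
    |φ x - x| ≤ 4 * nonlinNorm d1 d2 := by
  have hl := (h.expBound x hx (-1) (by simp) hx.1).1
  have hr := (h.expBound 1 (by simp) x hx hx.2).1
  rw [h.2.1] at hl
  rw [h.2.2.1] at hr
  have he := Real.add_one_le_exp (-2 * nonlinNorm d1 d2)
  have hs := nonlinNorm_nonneg d1 d2
  rw [abs_le]
  constructor <;> nlinarith [hx.1, hx.2]

end IsDiffeo

namespace ExpBound

variable {f g : ℝ → ℝ} {s t : ℝ}

lemma monotoneOn (hf : ExpBound f s) : MonotoneOn f (Icc (-1 : ℝ) 1) := by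
  intro y hy x hx hyx
  have := (hf x hx y hy hyx).1
  have := mul_nonneg (Real.exp_nonneg (-2 * s)) (sub_nonneg.2 hyx)
  linarith

lemma mono (hf : ExpBound f s) (hst : s ≤ t) : ExpBound f t := by
  intro x hx y hy hyx
  have hxy := sub_nonneg.2 hyx
  refine ⟨le_trans ?_ (hf x hx y hy hyx).1, (hf x hx y hy hyx).2.trans ?_⟩ <;>
  · refine mul_le_mul_of_nonneg_right (Real.exp_le_exp.2 ?_) hxy
    linarith

lemma comp (hf : ExpBound f s) (hg : ExpBound g t)
    (hm : MapsTo g (Icc (-1 : ℝ) 1) (Icc (-1 : ℝ) 1)) : ExpBound (f ∘ g) (s + t) := by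
  intro x hx y hy hyx
  obtain ⟨g1, g2⟩ := hg x hx y hy hyx
  obtain ⟨f1, f2⟩ := hf _ (hm hx) _ (hm hy) (hg.monotoneOn hy hx hyx)
  rw [mul_add, mul_add, Real.exp_add, Real.exp_add, mul_assoc, mul_assoc]
  exact ⟨(mul_le_mul_of_nonneg_left g1 (Real.exp_nonneg _)).trans f1,
    f2.trans (mul_le_mul_of_nonneg_left g2 (Real.exp_nonneg _))⟩

lemma abs_sub_le (hf : ExpBound f s) {x y : ℝ} (hx : x ∈ Icc (-1 : ℝ) 1)
    (hy : y ∈ Icc (-1 : ℝ) 1) : |f x - f y| ≤ Real.exp (2 * s) * |x - y| := by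
  wlog hyx : y ≤ x generalizing x y
  · rw [abs_sub_comm, abs_sub_comm x]
    exact this hy hx (le_of_not_ge hyx)
  rw [abs_of_nonneg (sub_nonneg.2 (hf.monotoneOn hy hx hyx)), abs_of_nonneg (sub_nonneg.2 hyx)]
  exact (hf x hx y hy hyx).2

lemma continuousOn (hf : ExpBound f s) : ContinuousOn f (Icc (-1 : ℝ) 1) :=
  (LipschitzOnWith.of_dist_le' fun _ hx _ hy => hf.abs_sub_le hx hy).continuousOn

lemma div_bounds (hf : ExpBound f s) {x y : ℝ} (hx : x ∈ Icc (-1 : ℝ) 1)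
    (hy : y ∈ Icc (-1 : ℝ) 1) (hxy : x ≠ y) :
    Real.exp (-2 * s) ≤ (f x - f y) / (x - y) ∧ (f x - f y) / (x - y) ≤ Real.exp (2 * s) := by
  wlog hyx : y < x generalizing x y
  · rw [← neg_sub (f y), ← neg_sub y, neg_div_neg_eq]
    exact this hy hx hxy.symm (lt_of_le_of_ne (le_of_not_gt hyx) hxy)
  rw [le_div_iff₀ (sub_pos.2 hyx), div_le_iff₀ (sub_pos.2 hyx)]
  exact hf x hx y hy hyx.le

lemma injOn (hf : ExpBound f s) : InjOn f (Icc (-1 : ℝ) 1) := by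
  intro x hx y hy hfxy
  by_contra hxy
  have := (hf.div_bounds hx hy hxy).1
  rw [hfxy, sub_self, zero_div] at this
  exact this.not_gt (Real.exp_pos _)

lemma bijOn (hf : ExpBound f s) (hl : f (-1) = -1) (hr : f 1 = 1) :
    BijOn f (Icc (-1 : ℝ) 1) (Icc (-1 : ℝ) 1) := by
  refine ⟨fun x hx => ⟨?_, ?_⟩, hf.injOn, ?_⟩
  · simpa [hl] using hf.monotoneOn (by simp) hx hx.1
  · simpa [hr] using hf.monotoneOn hx (by simp) hx.2
  · simpa [SurjOn, hl, hr] using intermediate_value_Icc (by norm_num) hf.continuousOn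

lemma of_tendsto {F : ℕ → ℝ → ℝ} (hF : ∀ n, ExpBound (F n) s)
    (hlim : ∀ x ∈ Icc (-1 : ℝ) 1, Tendsto (fun n => F n x) atTop (𝓝 (f x))) : ExpBound f s := by
  intro x hx y hy hyx
  have ht := (hlim x hx).sub (hlim y hy)
  exact ⟨ge_of_tendsto' ht fun n => (hF n x hx y hy hyx).1,
    le_of_tendsto' ht fun n => (hF n x hx y hy hyx).2⟩

end ExpBound

section partialComp

variable {φ d1 d2 : ℕ → ℝ → ℝ}

lemma partialComp_neg_one (hφ : ∀ n, IsDiffeo (φ n) (d1 n) (d2 n)) (n : ℕ) :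
    partialComp φ n (-1) = -1 := by
  induction n with
  | zero => exact (hφ 0).2.1
  | succ n ih => rw [partialComp, Function.comp_apply, (hφ (n + 1)).2.1, ih]

lemma partialComp_one (hφ : ∀ n, IsDiffeo (φ n) (d1 n) (d2 n)) (n : ℕ) :
    partialComp φ n 1 = 1 := by
  induction n with
  | zero => exact (hφ 0).2.2.1
  | succ n ih => rw [partialComp, Function.comp_apply, (hφ (n + 1)).2.2.1, ih]

lemma expBound_partialComp_sum (hφ : ∀ n, IsDiffeo (φ n) (d1 n) (d2 n)) (n : ℕ) :
    ExpBound (partialComp φ n) (∑ i ∈ Finset.range (n + 1), nonlinNorm (d1 i) (d2 i)) := by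
  induction n with
  | zero => simpa [partialComp] using (hφ 0).expBound
  | succ n ih =>
    rw [Finset.sum_range_succ]
    exact ih.comp (hφ (n + 1)).expBound (hφ (n + 1)).1.mapsTo

lemma expBound_partialComp (hφ : ∀ n, IsDiffeo (φ n) (d1 n) (d2 n))
    (hsum : Summable fun n => nonlinNorm (d1 n) (d2 n)) (n : ℕ) :
    ExpBound (partialComp φ n) (∑' i, nonlinNorm (d1 i) (d2 i)) :=
  (expBound_partialComp_sum hφ n).mono
    (hsum.sum_le_tsum _ fun i _ => nonlinNorm_nonneg (d1 i) (d2 i))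

lemma dist_partialComp_succ_le (hφ : ∀ n, IsDiffeo (φ n) (d1 n) (d2 n))
    (hsum : Summable fun n => nonlinNorm (d1 n) (d2 n)) {x : ℝ} (hx : x ∈ Icc (-1 : ℝ) 1)
    (n : ℕ) :
    dist (partialComp φ n x) (partialComp φ (n + 1) x) ≤
      Real.exp (2 * ∑' i, nonlinNorm (d1 i) (d2 i)) *
        (4 * nonlinNorm (d1 (n + 1)) (d2 (n + 1))) := by
  rw [dist_comm, Real.dist_eq]
  exact ((expBound_partialComp hφ hsum n).abs_sub_le ((hφ (n + 1)).1.mapsTo hx) hx).trans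
    (mul_le_mul_of_nonneg_left ((hφ (n + 1)).abs_sub_self_le hx) (Real.exp_nonneg _))

lemma exists_tendstoUniformlyOn_partialComp (hφ : ∀ n, IsDiffeo (φ n) (d1 n) (d2 n))
    (hsum : Summable fun n => nonlinNorm (d1 n) (d2 n)) :
    ∃ Ψ, TendstoUniformlyOn (partialComp φ) Ψ atTop (Icc (-1 : ℝ) 1) := by
  set d : ℕ → ℝ := fun n => Real.exp (2 * ∑' i, nonlinNorm (d1 i) (d2 i)) *
    (4 * nonlinNorm (d1 (n + 1)) (d2 (n + 1)))
  have hd : Summable d := (((summable_nat_add_iff 1).2 hsum).mul_left 4).mul_left _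
  have hlim : ∀ x, ∃ l, x ∈ Icc (-1 : ℝ) 1 →
      Tendsto (fun n => partialComp φ n x) atTop (𝓝 l) := by
    intro x
    by_cases hx : x ∈ Icc (-1 : ℝ) 1
    · obtain ⟨l, hl⟩ := cauchySeq_tendsto_of_complete
        (cauchySeq_of_dist_le_of_summable d (dist_partialComp_succ_le hφ hsum hx) hd)
      exact ⟨l, fun _ => hl⟩
    · exact ⟨0, fun h => absurd h hx⟩
  choose Ψ hΨ using hlim
  refine ⟨Ψ, Metric.tendstoUniformlyOn_iff.2 fun ε hε => ?_⟩
  filter_upwards [(tendsto_sum_nat_add d).eventually_lt_const hε] with n hn x hx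
  rw [dist_comm]
  refine (dist_le_tsum_of_dist_le_of_tendsto d (dist_partialComp_succ_le hφ hsum hx) hd
    (hΨ x hx) n).trans_lt ?_
  simpa only [add_comm] using hn

end partialComp

/-- Decompositions with summable nonlinearity can be composed: if `(φ_n)` is a sequence of
orientation-preserving C² diffeomorphisms of `[-1,1]` fixing the endpoints whose
nonlinearity sup-norms are summable with sum `S`, then the partial compositions
`Ψ_n = φ_0 ∘ ⋯ ∘ φ_n` converge uniformly on `[-1,1]` to a homeomorphism `Ψ` of `[-1,1]`
onto itself fixing the endpoints, which is bi-Lipschitz with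
`exp(-2S) ≤ (Ψ(x)-Ψ(y))/(x-y) ≤ exp(2S)` for all `x ≠ y`. -/
theorem decomposition_composition (φ d1 d2 : ℕ → ℝ → ℝ)
    (hφ : ∀ n, IsDiffeo (φ n) (d1 n) (d2 n))
    (hsum : Summable (fun n => sSup ((fun x => |d2 n x / d1 n x|) '' Set.Icc (-1 : ℝ) 1))) :
    ∃ Ψ : ℝ → ℝ,
      TendstoUniformlyOn (fun n => partialComp φ n) Ψ Filter.atTop (Set.Icc (-1 : ℝ) 1) ∧
      Set.BijOn Ψ (Set.Icc (-1 : ℝ) 1) (Set.Icc (-1 : ℝ) 1) ∧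
      ContinuousOn Ψ (Set.Icc (-1 : ℝ) 1) ∧
      Ψ (-1) = -1 ∧ Ψ 1 = 1 ∧
      ∀ x ∈ Set.Icc (-1 : ℝ) 1, ∀ y ∈ Set.Icc (-1 : ℝ) 1, x ≠ y →
        Real.exp (-2 * (∑' n, sSup ((fun x => |d2 n x / d1 n x|) '' Set.Icc (-1 : ℝ) 1))) ≤
            (Ψ x - Ψ y) / (x - y) ∧
          (Ψ x - Ψ y) / (x - y) ≤
            Real.exp (2 * (∑' n, sSup ((fun x => |d2 n x / d1 n x|) '' Set.Icc (-1 : ℝ) 1))) := by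
  obtain ⟨Ψ, hΨ⟩ := exists_tendstoUniformlyOn_partialComp hφ hsum
  have hlim := fun x (hx : x ∈ Icc (-1 : ℝ) 1) => hΨ.tendsto_at hx
  have hl : Ψ (-1) = -1 := tendsto_nhds_unique (hlim (-1) (by simp))
    (by simp only [partialComp_neg_one hφ, tendsto_const_nhds])
  have hr : Ψ 1 = 1 := tendsto_nhds_unique (hlim 1 (by simp))
    (by simp only [partialComp_one hφ, tendsto_const_nhds])
  have hb := ExpBound.of_tendsto (expBound_partialComp hφ hsum) hlim
  exact ⟨Ψ, hΨ, hb.bijOn hl hr, hb.continuousOn, hl, hr,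
    fun x hx y hy hxy => hb.div_bounds hx hy hxy⟩
end
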